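/- arXiv:2408.03459 — 5 statements merged into one kernel-verified Lean document; each statement's English description precedes it below -/
import Mathlib

section
/- Let V, d, N ≥ 1 be integers, β > 0 and τ > 0 reals, a_1, …, a_N ∈ ℝ^V, g_1, …, g_N ∈ ℝ^d, W₀ ∈ M_{V×d}(ℝ), and let f : ℝ → ℝ be differentiable. Suppose W : ℝ → M_{V×d}(ℝ) is differentiable and satisfies τ·W'(t) = (1/N)·Σ_{i=1}^N β·f'(β·a_iᵀ(W(t) − W₀)g_i)·a_i g_iᵀ for all t (the gradient flow of the generalized preference loss −(1/N)Σ_i f(β a_iᵀ(W−W₀)g_i)). Then the reward margins r_j(t) = β·a_jᵀ(W(t) − W₀)g_j are differentiable and satisfy τ·r_j'(t) = (β²/N)·Σ_{i=1}^N f'(r_i(t))·⟨a_j, a_i⟩·⟨g_i, g_j⟩ for all t and all j ∈ {1, …, N}. -/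
open Matrix

attribute [local instance] Matrix.frobeniusNormedAddCommGroup Matrix.frobeniusNormedSpace

/-- The linear functional `M ↦ uᵀ M v` on matrices. -/
def Matrix.bilinEval {m n : Type*} [Fintype m] [Fintype n] (u : m → ℝ) (v : n → ℝ) :
    Matrix m n ℝ →ₗ[ℝ] ℝ where
  toFun M := u ⬝ᵥ (M *ᵥ v)
  map_add' A B := by rw [add_mulVec, dotProduct_add]
  map_smul' c A := by rw [smul_mulVec, dotProduct_smul, RingHom.id_apply]

theorem Matrix.bilinEval_apply {m n : Type*} [Fintype m] [Fintype n] (u : m → ℝ) (v : n → ℝ)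
    (M : Matrix m n ℝ) : bilinEval u v M = u ⬝ᵥ (M *ᵥ v) := rfl

theorem Matrix.bilinEval_vecMulVec {m n : Type*} [Fintype m] [Fintype n] (u a : m → ℝ)
    (v b : n → ℝ) : bilinEval u v (vecMulVec a b) = (u ⬝ᵥ a) * (b ⬝ᵥ v) := by
  rw [bilinEval_apply, vecMulVec_mulVec, op_smul_eq_smul, dotProduct_smul, smul_eq_mul, mul_comm]

theorem HasDerivAt.matrix_bilinEval {m n : Type*} [Fintype m] [Fintype n] {W : ℝ → Matrix m n ℝ}
    {W' : Matrix m n ℝ} {t : ℝ} (hW : HasDerivAt W W' t) (u : m → ℝ) (v : n → ℝ) :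
    HasDerivAt (fun s => bilinEval u v (W s)) (bilinEval u v W') t :=
  (LinearMap.toContinuousLinearMap (bilinEval u v)).hasFDerivAt.comp_hasDerivAt t hW

/-- Under the gradient flow of the generalized preference (GPO-family) loss
`−(1/N)·Σ_i f(β·a_iᵀ(W − W₀)g_i)` with `f` differentiable, the reward margins
`r_j(t) = β·a_jᵀ(W(t) − W₀)g_j` are differentiable and satisfy
`τ·r_j'(t) = (β²/N)·Σ_i f'(r_i(t))·⟨a_j, a_i⟩·⟨g_i, g_j⟩`. -/
theorem gpo_reward_margin_dynamics (V d N : ℕ) (hV : 1 ≤ V) (hd : 1 ≤ d) (hN : 1 ≤ N)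
    (β τ : ℝ) (hβ : 0 < β) (hτ : 0 < τ)
    (a : Fin N → Fin V → ℝ) (g : Fin N → Fin d → ℝ)
    (W₀ : Matrix (Fin V) (Fin d) ℝ)
    (f : ℝ → ℝ) (hf : Differentiable ℝ f)
    (W W' : ℝ → Matrix (Fin V) (Fin d) ℝ)
    (hW : ∀ t, HasDerivAt W (W' t) t)
    (hflow : ∀ t, τ • W' t =
      (1 / (N : ℝ)) • ∑ i, (β * deriv f (β * (a i ⬝ᵥ ((W t - W₀) *ᵥ g i)))) •
        Matrix.vecMulVec (a i) (g i))
    (r : Fin N → ℝ → ℝ)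
    (hr : ∀ j t, r j t = β * (a j ⬝ᵥ ((W t - W₀) *ᵥ g j))) :
    ∀ (j : Fin N) (t : ℝ), ∃ r' : ℝ, HasDerivAt (r j) r' t ∧
      τ * r' = (β ^ 2 / (N : ℝ)) *
        ∑ i, deriv f (r i t) * (a j ⬝ᵥ a i) * (g i ⬝ᵥ g j) := by
  intro j t
  refine ⟨β * bilinEval (a j) (g j) (W' t), ?_, ?_⟩
  · rw [show r j = fun s => β * bilinEval (a j) (g j) (W s - W₀) from funext (hr j)]
    exact (((hW t).sub_const W₀).matrix_bilinEval (a j) (g j)).const_mul β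
  · have h := congrArg (bilinEval (a j) (g j)) (hflow t)
    simp only [map_smul, map_sum, bilinEval_vecMulVec, smul_eq_mul, ← hr] at h
    rw [mul_left_comm, h, Finset.mul_sum, Finset.mul_sum, Finset.mul_sum]
    refine Finset.sum_congr rfl fun i _ => ?_
    ring
end

section
/- There exists an absolute constant c₀ > 0 such that for every integer d ≥ 2 and all reals v > 0, ε > 0 and l_b ∈ [0, 1] the following holds. Let α be distributed according to γ_v^d and set x = l_b·e₁ + e₂ + α. Then the probability that |‖x‖² − (1 + l_b² + d·v²)| > 2εv is at most 2·exp(−ε²/16) + 2·exp(−c₀·(ε/v)·min(1, ε/(dv))). -/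
open MeasureTheory ProbabilityTheory Real

open scoped NNReal

lemma one_le_one_sub_mul_exp_add_sq {u : ℝ} (hu : |u| ≤ 1 / 2) :
    1 ≤ (1 - u) * exp (u + u ^ 2) := by
  obtain ⟨h₁, h₂⟩ := abs_le.mp hu
  rcases le_total 0 u with h | h
  · have hexp := quadratic_le_exp_of_nonneg (x := u + u ^ 2) (by positivity)
    have hcube : 0 ≤ 1 - u - u ^ 2 - u ^ 3 := by nlinarith [mul_nonneg h h, pow_nonneg h 3]
    calc (1 : ℝ) ≤ 1 + u ^ 2 / 2 * (1 - u - u ^ 2 - u ^ 3) := by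
          linarith [mul_nonneg (by positivity : 0 ≤ u ^ 2 / 2) hcube]
      _ = (1 - u) * (1 + (u + u ^ 2) + (u + u ^ 2) ^ 2 / 2) := by ring
      _ ≤ (1 - u) * exp (u + u ^ 2) := by gcongr; linarith
  · have hexp := add_one_le_exp (u + u ^ 2)
    calc (1 : ℝ) ≤ 1 + (-u) ^ 3 := by linarith [pow_nonneg (neg_nonneg.mpr h) 3]
      _ = (1 - u) * (u + u ^ 2 + 1) := by ring
      _ ≤ (1 - u) * exp (u + u ^ 2) := by gcongr; linarith

lemma inv_sqrt_one_sub_two_mul_le {t : ℝ} (ht : |t| ≤ 1 / 4) :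
    (√(1 - 2 * t))⁻¹ ≤ exp (t + 2 * t ^ 2) := by
  have hpos : 0 < 1 - 2 * t := by linarith [(abs_le.mp ht).2]
  have h := one_le_one_sub_mul_exp_add_sq (u := 2 * t) (by rw [abs_mul, abs_two]; linarith)
  rw [inv_le_iff_one_le_mul₀ (sqrt_pos.mpr hpos), ← one_le_sq_iff₀ (by positivity), mul_pow,
    sq_sqrt hpos.le, ← exp_nat_mul,
    show ((2 : ℕ) : ℝ) * (t + 2 * t ^ 2) = 2 * t + (2 * t) ^ 2 by push_cast; ring]
  linarith

lemma integral_exp_mul_sq_gaussianReal {w : ℝ≥0} (hw : w ≠ 0) {t : ℝ} (ht : t < 1 / 2) :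
    ∫ x, exp (t * (x ^ 2 / w)) ∂(gaussianReal 0 w) = (√(1 - 2 * t))⁻¹ := by
  have hw' : (0 : ℝ) < w := by positivity
  have hpos : 0 < 1 - 2 * t := by linarith
  have hexp : ∀ x : ℝ, gaussianPDFReal 0 w x • exp (t * (x ^ 2 / w)) =
      (√(2 * π * w))⁻¹ * exp (-((1 - 2 * t) / (2 * w)) * x ^ 2) := by
    intro x
    rw [gaussianPDFReal, smul_eq_mul, mul_assoc, ← exp_add]
    congr 2
    field_simp
    ring
  simp_rw [integral_gaussianReal_eq_integral_smul hw, hexp]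
  rw [integral_const_mul, integral_gaussian, ← sqrt_inv, ← sqrt_inv, ← sqrt_mul (by positivity)]
  congr 1
  field_simp

lemma integrable_exp_mul_sq_gaussianReal {w : ℝ≥0} (hw : w ≠ 0) {t : ℝ} (ht : t < 1 / 2) :
    Integrable (fun x ↦ exp (t * (x ^ 2 / w))) (gaussianReal 0 w) := by
  refine Integrable.of_integral_ne_zero ?_
  rw [integral_exp_mul_sq_gaussianReal hw ht]
  have : 0 < 1 - 2 * t := by linarith
  positivity

lemma integrable_exp_mul_sq_sub_one_gaussianReal {w : ℝ≥0} (hw : w ≠ 0) {t : ℝ}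
    (ht : t < 1 / 2) :
    Integrable (fun x ↦ exp (t * (x ^ 2 / w - 1))) (gaussianReal 0 w) := by
  simp_rw [mul_sub, exp_sub]
  exact (integrable_exp_mul_sq_gaussianReal hw ht).div_const _

lemma mgf_sq_sub_one_gaussianReal_le {w : ℝ≥0} (hw : w ≠ 0) {t : ℝ} (ht : |t| ≤ 1 / 4) :
    mgf (fun x ↦ x ^ 2 / w - 1) (gaussianReal 0 w) t ≤ exp (2 * t ^ 2) := by
  have ht' : t < 1 / 2 := by linarith [(abs_le.mp ht).2]
  simp_rw [mgf, mul_sub, exp_sub]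
  rw [integral_div, integral_exp_mul_sq_gaussianReal hw ht', div_le_iff₀ (exp_pos _), ← exp_add]
  refine (inv_sqrt_one_sub_two_mul_le ht).trans_eq ?_
  congr 1
  ring

lemma hasSubgaussianMGF_id_gaussianReal (w : ℝ≥0) :
    HasSubgaussianMGF id w (gaussianReal 0 w) where
  integrable_exp_mul t := integrable_exp_mul_gaussianReal t
  mgf_le t := by
    rw [mgf_gaussianReal (p := gaussianReal 0 w) (X := id) Measure.map_id t, zero_mul, zero_add]

section PiGaussian

variable {ι : Type*} [Fintype ι]

lemma hasSubgaussianMGF_sum_mul_pi_gaussianReal (a : ι → ℝ) (w : ℝ≥0) :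
    HasSubgaussianMGF (fun α : ι → ℝ ↦ ∑ i, a i * α i) (∑ i, ⟨a i ^ 2, sq_nonneg _⟩ * w)
      (Measure.pi fun _ : ι ↦ gaussianReal 0 w) := by
  refine HasSubgaussianMGF.sum_of_iIndepFun
    (iIndepFun_pi (X := fun i x ↦ a i * x) fun i ↦ by fun_prop) fun i _ ↦ ?_
  refine HasSubgaussianMGF.const_mul ?_ (a i)
  refine HasSubgaussianMGF.of_map (X := id) (measurable_pi_apply i).aemeasurable ?_
  rw [(measurePreserving_eval (fun _ : ι ↦ gaussianReal 0 w) i).map_eq]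
  exact hasSubgaussianMGF_id_gaussianReal w

lemma measureReal_le_abs_sum_mul_pi_gaussianReal_le (a : ι → ℝ) (w : ℝ≥0) {s : ℝ} (hs : 0 ≤ s) :
    (Measure.pi fun _ : ι ↦ gaussianReal 0 w).real {α | s ≤ |∑ i, a i * α i|} ≤
      2 * exp (-s ^ 2 / (2 * ((∑ i, a i ^ 2) * w))) := by
  have h := hasSubgaussianMGF_sum_mul_pi_gaussianReal a w
  have hunion : {α : ι → ℝ | s ≤ |∑ i, a i * α i|} =
      {α | s ≤ ∑ i, a i * α i} ∪ {α | s ≤ -∑ i, a i * α i} := by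
    ext α
    simp [le_abs]
  have hu := h.measure_ge_le hs
  have hl := h.neg.measure_ge_le hs
  have hparam : ((∑ i, ⟨a i ^ 2, sq_nonneg _⟩ * w : ℝ≥0) : ℝ) = (∑ i, a i ^ 2) * w := by
    rw [NNReal.coe_sum, Finset.sum_mul]
    rfl
  rw [hparam] at hu hl
  simp only [Pi.neg_apply] at hl
  rw [hunion]
  refine (measureReal_union_le _ _).trans ?_
  linarith

lemma integrable_exp_mul_sum_sq_sub_one_pi_gaussianReal {w : ℝ≥0} (hw : w ≠ 0) {t : ℝ}
    (ht : t < 1 / 2) :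
    Integrable (fun α : ι → ℝ ↦ exp (t * ∑ i, (α i ^ 2 / w - 1)))
      (Measure.pi fun _ : ι ↦ gaussianReal 0 w) := by
  simp_rw [Finset.mul_sum, exp_sum]
  exact Integrable.fintype_prod fun _ ↦ integrable_exp_mul_sq_sub_one_gaussianReal hw ht

lemma mgf_sum_sq_sub_one_pi_gaussianReal_le {w : ℝ≥0} (hw : w ≠ 0) {t : ℝ} (ht : |t| ≤ 1 / 4) :
    mgf (fun α : ι → ℝ ↦ ∑ i, (α i ^ 2 / w - 1)) (Measure.pi fun _ : ι ↦ gaussianReal 0 w) t ≤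
      exp (2 * t ^ 2 * Fintype.card ι) := by
  simp_rw [mgf, Finset.mul_sum, exp_sum]
  rw [integral_fintype_prod_eq_prod (fun _ x ↦ exp (t * (x ^ 2 / w - 1))),
    Finset.prod_const, Finset.card_univ, mul_comm, exp_nat_mul]
  gcongr
  exact mgf_sq_sub_one_gaussianReal_le hw ht

/-- **Bernstein-type bound** for the chi-squared distribution. -/
lemma measureReal_le_abs_sum_sq_sub_one_pi_gaussianReal_le [Nonempty ι] {w : ℝ≥0} (hw : w ≠ 0)
    {s : ℝ} (hs : 0 ≤ s) :
    (Measure.pi fun _ : ι ↦ gaussianReal 0 w).real {α | s ≤ |∑ i, (α i ^ 2 / w - 1)|} ≤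
      2 * exp (-(1 / 8) * s * min 1 (s / Fintype.card ι)) := by
  set n : ℝ := (Fintype.card ι : ℝ)
  set m : ℝ := min 1 (s / n)
  have hn : 0 < n := by simp [n, Fintype.card_pos]
  have hm0 : 0 ≤ m := le_min zero_le_one (by positivity)
  have hm1 : m ≤ 1 := min_le_left _ _
  have hms : m * n ≤ s := (le_div_iff₀ hn).mp (min_le_right _ _)
  have hbound : -(m / 4) * s + 2 * (m / 4) ^ 2 * n ≤ -(1 / 8) * s * m := by
    nlinarith [mul_le_mul_of_nonneg_left hms hm0]
  have habs : |m / 4| ≤ 1 / 4 := by rw [abs_of_nonneg (by positivity)]; linarith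
  have habs' : |-(m / 4)| ≤ 1 / 4 := by rwa [abs_neg]
  have hunion : {α : ι → ℝ | s ≤ |∑ i, (α i ^ 2 / w - 1)|} =
      {α | s ≤ ∑ i, (α i ^ 2 / (w : ℝ) - 1)} ∪ {α | ∑ i, (α i ^ 2 / (w : ℝ) - 1) ≤ -s} := by
    ext α
    simp only [le_abs, Set.mem_ofPred_eq, Set.mem_union]
    rw [le_neg]
  have hu := measure_ge_le_exp_mul_mgf s (t := m / 4) (by positivity)
    (integrable_exp_mul_sum_sq_sub_one_pi_gaussianReal (ι := ι) hw (by linarith))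
  have hl := measure_le_le_exp_mul_mgf (-s) (t := -(m / 4)) (by linarith)
    (integrable_exp_mul_sum_sq_sub_one_pi_gaussianReal (ι := ι) hw (by linarith))
  replace hu := hu.trans (mul_le_mul_of_nonneg_left
    (mgf_sum_sq_sub_one_pi_gaussianReal_le hw habs) (exp_pos _).le)
  replace hl := hl.trans (mul_le_mul_of_nonneg_left
    (mgf_sum_sq_sub_one_pi_gaussianReal_le hw habs') (exp_pos _).le)
  rw [neg_neg, mul_neg, ← neg_mul, neg_sq] at hl
  rw [← exp_add] at hu hl
  have hexp := exp_le_exp.mpr hbound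
  rw [hunion]
  refine (measureReal_union_le _ _).trans ?_
  linarith

/-- Concentration of the squared norm of a Gaussian vector with independent coordinates
of variance `v²`, shifted by `a`. -/
lemma measureReal_lt_abs_sum_add_sq_sub_pi_gaussianReal_le [Nonempty ι] (a : ι → ℝ) {v ε : ℝ}
    (hv : 0 < v) (hε : 0 < ε) :
    (Measure.pi fun _ : ι ↦ gaussianReal 0 (v.toNNReal ^ 2)).real
        {α | 2 * ε * v <
          |∑ i, (a i + α i) ^ 2 - (∑ i, a i ^ 2 + Fintype.card ι * v ^ 2)|} ≤
      2 * exp (-ε ^ 2 / (8 * ∑ i, a i ^ 2)) +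
        2 * exp (-(1 / 8) * (ε / v) * min 1 (ε / (Fintype.card ι * v))) := by
  have hw : v.toNNReal ^ 2 ≠ 0 := by simp [hv]
  have hwv : ((v.toNNReal ^ 2 : ℝ≥0) : ℝ) = v ^ 2 := by simp [hv.le]
  have hlin := measureReal_le_abs_sum_mul_pi_gaussianReal_le a (v.toNNReal ^ 2)
    (s := ε * v / 2) (by positivity)
  have hsq := measureReal_le_abs_sum_sq_sub_one_pi_gaussianReal_le (ι := ι) hw
    (s := ε / v) (by positivity)
  rw [hwv] at hlin hsq
  have hexp : -(ε * v / 2) ^ 2 / (2 * ((∑ i, a i ^ 2) * v ^ 2)) =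
      -ε ^ 2 / (8 * ∑ i, a i ^ 2) := by
    rw [show -(ε * v / 2) ^ 2 = -ε ^ 2 * (v ^ 2 / 4) by ring,
      show 2 * ((∑ i, a i ^ 2) * v ^ 2) = 8 * (∑ i, a i ^ 2) * (v ^ 2 / 4) by ring]
    exact mul_div_mul_right _ _ (by positivity)
  rw [hexp] at hlin
  rw [div_div, mul_comm v] at hsq
  refine le_trans ?_ (add_le_add hlin hsq)
  refine (measureReal_mono (fun α hα ↦ ?_)).trans (measureReal_union_le _ _)
  by_contra hcon
  simp only [Set.mem_union, Set.mem_ofPred_eq, not_or, not_le] at hα hcon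
  obtain ⟨h₁, h₂⟩ := hcon
  have hsplit : ∑ i, (a i + α i) ^ 2 - (∑ i, a i ^ 2 + Fintype.card ι * v ^ 2) =
      2 * ∑ i, a i * α i + v ^ 2 * ∑ i, (α i ^ 2 / v ^ 2 - 1) := by
    have hcancel : v ^ 2 * ∑ i, (α i ^ 2 / v ^ 2 - 1) =
        ∑ i, α i ^ 2 - Fintype.card ι * v ^ 2 := by
      rw [Finset.sum_sub_distrib, ← Finset.sum_div, mul_sub, mul_div_cancel₀ _ (by positivity)]
      simp [mul_comm]
    rw [hcancel]
    simp only [add_sq, Finset.sum_add_distrib, mul_assoc, ← Finset.mul_sum]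
    ring
  rw [hsplit] at hα
  have h₃ : v ^ 2 * |∑ i, (α i ^ 2 / v ^ 2 - 1)| < ε * v := by
    calc _ < v ^ 2 * (ε / v) := by gcongr
      _ = ε * v := by field_simp
  have h₄ := abs_add_le (2 * ∑ i, a i * α i) (v ^ 2 * ∑ i, (α i ^ 2 / v ^ 2 - 1))
  rw [abs_mul, abs_mul, abs_two, abs_of_pos (by positivity : 0 < v ^ 2)] at h₄
  linarith

end PiGaussian

/-- Concentration of the squared norm of a cluster sample `x = l_b·e₁ + e₂ + α` with
Gaussian noise `α ~ N(0, v²I_d)`: with the stated probability bound,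
`|‖x‖² − (1 + l_b² + d·v²)| ≤ 2εv`. -/
theorem cluster_sample_norm_concentration :
    ∃ c₀ : ℝ, 0 < c₀ ∧
      ∀ (d : ℕ) (hd : 2 ≤ d) (v ε lb : ℝ), 0 < v → 0 < ε → 0 ≤ lb → lb ≤ 1 →
        (Measure.pi fun _ : Fin d => gaussianReal 0 (v.toNNReal ^ 2))
          {α : Fin d → ℝ |
            2 * ε * v <
              |(∑ m, ((lb • (Pi.single (⟨0, by omega⟩ : Fin d) (1 : ℝ) : Fin d → ℝ)
                  + (Pi.single (⟨1, by omega⟩ : Fin d) (1 : ℝ) : Fin d → ℝ) + α) m) ^ 2)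
                - (1 + lb ^ 2 + d * v ^ 2)|}
          ≤ ENNReal.ofReal
              (2 * exp (-ε ^ 2 / 16) + 2 * exp (-c₀ * (ε / v) * min 1 (ε / (d * v)))) := by
  refine ⟨1 / 8, by norm_num, fun d hd v ε lb hv hε hlb0 hlb1 ↦ ?_⟩
  have : NeZero d := ⟨by omega⟩
  set a : Fin d → ℝ := lb • (Pi.single (⟨0, by omega⟩ : Fin d) (1 : ℝ) : Fin d → ℝ)
    + (Pi.single (⟨1, by omega⟩ : Fin d) (1 : ℝ) : Fin d → ℝ) with ha
  have hne : (⟨0, by omega⟩ : Fin d) ≠ ⟨1, by omega⟩ := by simp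
  have hnorm : ∑ i, a i ^ 2 = 1 + lb ^ 2 := by
    rw [Fintype.sum_eq_add _ _ hne fun i hi ↦ by
      simp only [ha, Pi.add_apply, Pi.smul_apply, Pi.single_eq_of_ne hi.1,
        Pi.single_eq_of_ne hi.2, smul_zero, add_zero, ne_eq, two_ne_zero, not_false_eq_true, zero_pow]]
    simp only [ha, Pi.add_apply, Pi.smul_apply, Pi.single_eq_same, Pi.single_eq_of_ne hne,
      Pi.single_eq_of_ne hne.symm, smul_eq_mul]
    ring
  have hmain := measureReal_lt_abs_sum_add_sq_sub_pi_gaussianReal_le a hv hε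
  rw [hnorm, Fintype.card_fin] at hmain
  rw [← ofReal_measureReal]
  refine ENNReal.ofReal_le_ofReal (hmain.trans ?_)
  have hlb : 8 * (1 + lb ^ 2) ≤ 16 := by nlinarith
  simp only [neg_div]
  gcongr
end

section
/- There exists an absolute constant c₀ > 0 such that for every integer d ≥ 2 and all reals v > 0, ε > 0 and l_b ∈ [0, 1] the following holds. Let (α, α') be distributed according to γ_v^d ⊗ γ_v^d (two independent vectors with i.i.d. N(0, v²) coordinates) and set x = l_b·e₁ + e₂ + α and x' = l_b·e₁ + e₂ + α'. Then the probability that |⟨x, x'⟩ − (1 + l_b²)| > 2εv is at most 2·exp(−ε²/16) + 2·exp(−c₀·(ε/v)·min(1, ε/(dv))). -/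
open MeasureTheory ProbabilityTheory Real

open scoped ENNReal NNReal

/-- Chernoff bound: a bound on the moment generating function at `s ≥ 0` controls the upper tail. -/
lemma measure_lt_le_of_lintegral_exp_le {Ω : Type*} [MeasurableSpace Ω] {μ : Measure Ω}
    {X : Ω → ℝ} (hX : Measurable X) {s k t : ℝ} (hs : 0 ≤ s)
    (h : ∫⁻ ω, ENNReal.ofReal (exp (s * X ω)) ∂μ ≤ ENNReal.ofReal (exp k)) :
    μ {ω | t < X ω} ≤ ENNReal.ofReal (exp (k - s * t)) := by
  have hsub : {ω | t < X ω} ⊆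
      {ω | ENNReal.ofReal (exp (s * t)) ≤ ENNReal.ofReal (exp (s * X ω))} := fun ω hω =>
    ENNReal.ofReal_le_ofReal (exp_le_exp.2 (mul_le_mul_of_nonneg_left (le_of_lt hω) hs))
  calc μ {ω | t < X ω}
      ≤ μ {ω | ENNReal.ofReal (exp (s * t)) ≤ ENNReal.ofReal (exp (s * X ω))} := measure_mono hsub
    _ ≤ (∫⁻ ω, ENNReal.ofReal (exp (s * X ω)) ∂μ) / ENNReal.ofReal (exp (s * t)) :=
        meas_ge_le_lintegral_div (by fun_prop) (by simp [exp_pos]) ENNReal.ofReal_ne_top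
    _ ≤ ENNReal.ofReal (exp k) / ENNReal.ofReal (exp (s * t)) := by gcongr
    _ = ENNReal.ofReal (exp (k - s * t)) := by
        rw [← ENNReal.ofReal_div_of_pos (exp_pos _), exp_sub]

/-- Two-sided Chernoff bound. -/
lemma measure_lt_abs_le_of_lintegral_exp_le {Ω : Type*} [MeasurableSpace Ω] {μ : Measure Ω}
    {X : Ω → ℝ} (hX : Measurable X) {s k t : ℝ} (hs : 0 ≤ s)
    (h : ∫⁻ ω, ENNReal.ofReal (exp (s * X ω)) ∂μ ≤ ENNReal.ofReal (exp k))
    (h' : ∫⁻ ω, ENNReal.ofReal (exp (-s * X ω)) ∂μ ≤ ENNReal.ofReal (exp k)) :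
    μ {ω | t < |X ω|} ≤ ENNReal.ofReal (2 * exp (k - s * t)) := by
  have hsub : {ω | t < |X ω|} = {ω | t < X ω} ∪ {ω | t < (-X) ω} := by
    ext ω
    simp [lt_abs]
  rw [hsub, two_mul, ENNReal.ofReal_add (exp_pos _).le (exp_pos _).le]
  refine (measure_union_le _ _).trans (add_le_add
    (measure_lt_le_of_lintegral_exp_le hX hs h)
    (measure_lt_le_of_lintegral_exp_le hX.neg hs ?_))
  simpa using h'

lemma lintegral_pi_prod_eq_prod_lintegral {ι : Type*} [Fintype ι] {E : ι → Type*}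
    [∀ i, MeasurableSpace (E i)] (μ : ∀ i, Measure (E i)) [∀ i, IsProbabilityMeasure (μ i)]
    {f : ∀ i, E i → ℝ≥0∞} (hf : ∀ i, Measurable (f i)) :
    ∫⁻ x, ∏ i, f i (x i) ∂Measure.pi μ = ∏ i, ∫⁻ y, f i y ∂μ i := by
  have hind : iIndepFun (fun i (x : ∀ i, E i) => f i (x i)) (Measure.pi μ) :=
    iIndepFun_pi (X := f) fun i => (hf i).aemeasurable
  rw [lintegral_prod_eq_prod_lintegral_of_indepFun Finset.univ _ hind
    fun i => (hf i).comp (measurable_pi_apply i)]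
  exact Finset.prod_congr rfl fun i _ => (measurePreserving_eval μ i).lintegral_comp (hf i)

lemma lintegral_exp_mul_gaussianReal (w : ℝ≥0) (a : ℝ) :
    ∫⁻ y, ENNReal.ofReal (exp (a * y)) ∂gaussianReal 0 w
      = ENNReal.ofReal (exp (w * a ^ 2 / 2)) := by
  rw [← ofReal_integral_eq_lintegral_ofReal (integrable_exp_mul_gaussianReal a)
    (.of_forall fun _ => (exp_pos _).le)]
  have h := congrFun (mgf_fun_id_gaussianReal (μ := 0) (v := w)) a
  rw [mgf] at h
  rw [h, zero_mul, zero_add]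

lemma lintegral_exp_sum_mul_pi_gaussianReal {ι : Type*} [Fintype ι] (w : ℝ≥0) (a : ι → ℝ) :
    ∫⁻ x, ENNReal.ofReal (exp (∑ i, a i * x i)) ∂(Measure.pi fun _ : ι => gaussianReal 0 w)
      = ENNReal.ofReal (exp (∑ i, w * a i ^ 2 / 2)) := by
  simp_rw [exp_sum, ENNReal.ofReal_prod_of_nonneg fun _ _ => (exp_pos _).le]
  rw [lintegral_pi_prod_eq_prod_lintegral (fun _ => gaussianReal 0 w)
    (f := fun i y => ENNReal.ofReal (exp (a i * y))) fun i => by fun_prop]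
  simp_rw [lintegral_exp_mul_gaussianReal]

lemma lintegral_exp_mul_sq_gaussianReal_le {w : ℝ≥0} (hw : w ≠ 0) {a : ℝ} (ha : 0 ≤ a)
    (haw : 4 * a * w ≤ 1) :
    ∫⁻ y, ENNReal.ofReal (exp (a * y ^ 2)) ∂gaussianReal 0 w
      ≤ ENNReal.ofReal (exp (2 * a * w)) := by
  have hw' : (0 : ℝ) < w := by positivity
  have hb : 0 < 1 / (2 * w) - a := by
    rw [sub_pos, lt_div_iff₀ (by positivity)]
    linarith
  have hint := integrable_exp_neg_mul_sq hb
  rw [gaussianReal_of_var_ne_zero _ hw,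
    lintegral_withDensity_eq_lintegral_mul _ (measurable_gaussianPDF 0 w) (by fun_prop)]
  have heq : ∀ y : ℝ, (gaussianPDF 0 w * fun y => ENNReal.ofReal (exp (a * y ^ 2))) y
      = ENNReal.ofReal ((√(2 * π * w))⁻¹ * exp (-(1 / (2 * w) - a) * y ^ 2)) := fun y => by
    rw [Pi.mul_apply, gaussianPDF, ← ENNReal.ofReal_mul (gaussianPDFReal_nonneg _ _ _),
      gaussianPDFReal, mul_assoc, ← exp_add]
    congr 3
    field_simp
    ring
  simp_rw [heq]
  rw [← ofReal_integral_eq_lintegral_ofReal (hint.const_mul _)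
    (.of_forall fun _ => by positivity), integral_const_mul, integral_gaussian]
  refine ENNReal.ofReal_le_ofReal ?_
  rw [← sqrt_inv, ← sqrt_mul (by positivity)]
  refine sqrt_le_iff.2 ⟨(exp_pos _).le, ?_⟩
  have hq : 0 < 1 - 2 * a * w := by linarith
  have hval : (2 * π * w)⁻¹ * (π / (1 / (2 * w) - a)) = 1 / (1 - 2 * a * w) := by
    have : 1 / (2 * (w : ℝ)) - a = (1 - 2 * a * w) / (2 * w) := by field_simp
    rw [this]
    field_simp
  rw [hval, div_le_iff₀ hq, ← exp_nat_mul]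
  have haw0 : 0 ≤ a * w := by positivity
  have hexp := add_one_le_exp (((2 : ℕ) : ℝ) * (2 * a * w))
  push_cast at hexp ⊢
  nlinarith [mul_le_mul_of_nonneg_right hexp hq.le, mul_nonneg haw0 (sub_nonneg.2 haw)]

lemma lintegral_exp_inner_prod_gaussianReal_le {ι : Type*} [Fintype ι] {w : ℝ≥0} (hw : w ≠ 0)
    {s : ℝ} (hs : 2 * (s * w) ^ 2 ≤ 1) :
    ∫⁻ p, ENNReal.ofReal (exp (s * ∑ i, p.1 i * p.2 i))
        ∂((Measure.pi fun _ : ι => gaussianReal 0 w).prod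
          (Measure.pi fun _ : ι => gaussianReal 0 w))
      ≤ ENNReal.ofReal (exp (Fintype.card ι * (s * w) ^ 2)) := by
  rw [lintegral_prod _ (by fun_prop)]
  have hinner : ∀ x : ι → ℝ, ∫⁻ y, ENNReal.ofReal (exp (s * ∑ i, x i * y i))
        ∂(Measure.pi fun _ : ι => gaussianReal 0 w)
      = ∏ i, ENNReal.ofReal (exp (w * s ^ 2 / 2 * x i ^ 2)) := fun x => by
    rw [← ENNReal.ofReal_prod_of_nonneg fun _ _ => (exp_pos _).le, ← exp_sum]
    simp_rw [Finset.mul_sum, ← mul_assoc]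
    rw [lintegral_exp_sum_mul_pi_gaussianReal w fun i => s * x i]
    congr! 3
    ring
  simp_rw [hinner]
  rw [lintegral_pi_prod_eq_prod_lintegral (fun _ => gaussianReal 0 w)
    (f := fun _ y => ENNReal.ofReal (exp (w * s ^ 2 / 2 * y ^ 2))) fun i => by fun_prop]
  rw [Finset.prod_const, Finset.card_univ, exp_nat_mul, ENNReal.ofReal_pow (exp_pos _).le]
  gcongr
  refine (lintegral_exp_mul_sq_gaussianReal_le hw (by positivity) (by linarith)).trans_eq ?_
  ring_nf

lemma lintegral_exp_linear_prod_gaussianReal {ι : Type*} [Fintype ι] (w : ℝ≥0) (u : ι → ℝ)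
    (s : ℝ) :
    ∫⁻ p, ENNReal.ofReal (exp (s * ∑ i, u i * (p.1 i + p.2 i)))
        ∂((Measure.pi fun _ : ι => gaussianReal 0 w).prod
          (Measure.pi fun _ : ι => gaussianReal 0 w))
      = ENNReal.ofReal (exp (w * s ^ 2 * ∑ i, u i ^ 2)) := by
  have hsplit : ∀ p : (ι → ℝ) × (ι → ℝ),
      ENNReal.ofReal (exp (s * ∑ i, u i * (p.1 i + p.2 i)))
        = ENNReal.ofReal (exp (∑ i, s * u i * p.1 i))
          * ENNReal.ofReal (exp (∑ i, s * u i * p.2 i)) := fun p => by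
    rw [← ENNReal.ofReal_mul (exp_pos _).le, ← exp_add, ← Finset.sum_add_distrib, Finset.mul_sum]
    congr! 3
    ring
  simp_rw [hsplit]
  rw [lintegral_prod_mul (f := fun x : ι → ℝ => ENNReal.ofReal (exp (∑ i, s * u i * x i)))
      (g := fun x : ι → ℝ => ENNReal.ofReal (exp (∑ i, s * u i * x i)))
      (Measurable.aemeasurable (by fun_prop)) (Measurable.aemeasurable (by fun_prop)),
    lintegral_exp_sum_mul_pi_gaussianReal w fun i => s * u i,
    ← ENNReal.ofReal_mul (exp_pos _).le, ← exp_add, ← Finset.sum_add_distrib, Finset.mul_sum]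
  congr! 3
  ring

lemma measure_lt_abs_linear_prod_gaussianReal_le {ι : Type*} [Fintype ι] {v ε : ℝ} (hv : 0 < v)
    (hε : 0 < ε) {u : ι → ℝ} (hu : ∑ i, u i ^ 2 ≤ 2) :
    ((Measure.pi fun _ : ι => gaussianReal 0 (v.toNNReal ^ 2)).prod
        (Measure.pi fun _ : ι => gaussianReal 0 (v.toNNReal ^ 2)))
      {p | ε * v < |∑ i, u i * (p.1 i + p.2 i)|} ≤ ENNReal.ofReal (2 * exp (-ε ^ 2 / 8)) := by
  have hw : ((v.toNNReal ^ 2 : ℝ≥0) : ℝ) = v ^ 2 := by simp [hv.le]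
  have hk : ∀ s : ℝ, s ^ 2 = (ε / (4 * v)) ^ 2 →
      ENNReal.ofReal (exp ((v.toNNReal ^ 2 : ℝ≥0) * s ^ 2 * ∑ i, u i ^ 2))
        ≤ ENNReal.ofReal (exp (ε ^ 2 / 8)) := fun s hs => by
    refine ENNReal.ofReal_le_ofReal (exp_le_exp.2 ?_)
    have : v ^ 2 * (ε / (4 * v)) ^ 2 = ε ^ 2 / 16 := by
      field_simp
      norm_num
    rw [hw, hs, this]
    nlinarith [sq_nonneg ε]
  refine (measure_lt_abs_le_of_lintegral_exp_le (by fun_prop) (s := ε / (4 * v))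
    (by positivity)
    ((lintegral_exp_linear_prod_gaussianReal _ u _).trans_le (hk _ rfl))
    ((lintegral_exp_linear_prod_gaussianReal _ u _).trans_le (hk _ (neg_sq _)))).trans_eq ?_
  congr 3
  field_simp
  ring

lemma measure_lt_abs_inner_prod_gaussianReal_le {ι : Type*} [Fintype ι] [Nonempty ι] {v ε : ℝ}
    (hv : 0 < v) (hε : 0 < ε) :
    ((Measure.pi fun _ : ι => gaussianReal 0 (v.toNNReal ^ 2)).prod
        (Measure.pi fun _ : ι => gaussianReal 0 (v.toNNReal ^ 2)))
      {p | ε * v < |∑ i, p.1 i * p.2 i|}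
      ≤ ENNReal.ofReal
        (2 * exp (-(1 / 4) * (ε / v) * min 1 (ε / (Fintype.card ι * v)))) := by
  have hw : ((v.toNNReal ^ 2 : ℝ≥0) : ℝ) = v ^ 2 := by simp [hv.le]
  have hw0 : v.toNNReal ^ 2 ≠ 0 := by simp [hv]
  have hd : (0 : ℝ) < Fintype.card ι := by exact_mod_cast Fintype.card_pos
  set m := min 1 (ε / (Fintype.card ι * v)) with hm
  have hm0 : 0 < m := lt_min one_pos (by positivity)
  have hm1 : m ≤ 1 := min_le_left _ _
  have hmd : Fintype.card ι * m ≤ ε / v := by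
    calc Fintype.card ι * m ≤ Fintype.card ι * (ε / (Fintype.card ι * v)) := by
          gcongr
          exact min_le_right _ _
      _ = ε / v := by field_simp
  have hsw : m / (2 * v ^ 2) * (v.toNNReal ^ 2 : ℝ≥0) = m / 2 := by
    rw [hw]
    field_simp
  have hsw' : -(m / (2 * v ^ 2)) * (v.toNNReal ^ 2 : ℝ≥0) = -(m / 2) := by
    rw [neg_mul, hsw]
  have h₁ := lintegral_exp_inner_prod_gaussianReal_le (ι := ι) hw0 (s := m / (2 * v ^ 2))
    (by rw [hsw]; nlinarith)
  have h₂ := lintegral_exp_inner_prod_gaussianReal_le (ι := ι) hw0 (s := -(m / (2 * v ^ 2)))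
    (by rw [hsw']; nlinarith)
  rw [hsw] at h₁
  rw [hsw', neg_sq] at h₂
  refine (measure_lt_abs_le_of_lintegral_exp_le (by fun_prop) (by positivity) h₁ h₂).trans
    (ENNReal.ofReal_le_ofReal ?_)
  gcongr
  have : m / (2 * v ^ 2) * (ε * v) = m * (ε / v) / 2 := by field_simp
  rw [this]
  nlinarith [mul_le_mul_of_nonneg_left hmd hm0.le]

/-- Concentration of the inner product of two independent samples
`x = l_b·e₁ + e₂ + α`, `x' = l_b·e₁ + e₂ + α'` from the same cluster, with Gaussian
noises `α, α' ~ N(0, v²I_d)`: with the stated probability bound,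
`|⟨x, x'⟩ − (1 + l_b²)| ≤ 2εv`. -/
theorem same_cluster_inner_concentration :
    ∃ c₀ : ℝ, 0 < c₀ ∧
      ∀ (d : ℕ) (hd : 2 ≤ d) (v ε lb : ℝ), 0 < v → 0 < ε → 0 ≤ lb → lb ≤ 1 →
        ((Measure.pi fun _ : Fin d => gaussianReal 0 (v.toNNReal ^ 2)).prod
            (Measure.pi fun _ : Fin d => gaussianReal 0 (v.toNNReal ^ 2)))
          {p : (Fin d → ℝ) × (Fin d → ℝ) |
            2 * ε * v <
              |(∑ m, ((lb • (Pi.single (⟨0, by omega⟩ : Fin d) (1 : ℝ) : Fin d → ℝ)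
                    + (Pi.single (⟨1, by omega⟩ : Fin d) (1 : ℝ) : Fin d → ℝ) + p.1) m)
                  * ((lb • (Pi.single (⟨0, by omega⟩ : Fin d) (1 : ℝ) : Fin d → ℝ)
                    + (Pi.single (⟨1, by omega⟩ : Fin d) (1 : ℝ) : Fin d → ℝ) + p.2) m))
                - (1 + lb ^ 2)|}
          ≤ ENNReal.ofReal
              (2 * exp (-ε ^ 2 / 16) + 2 * exp (-c₀ * (ε / v) * min 1 (ε / (d * v)))) := by
  refine ⟨1 / 4, by norm_num, fun d hd v ε lb hv hε hlb0 hlb1 => ?_⟩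
  set i₀ : Fin d := ⟨0, by omega⟩
  set i₁ : Fin d := ⟨1, by omega⟩
  have : Nonempty (Fin d) := ⟨i₀⟩
  have hne : i₀ ≠ i₁ := by simp [i₀, i₁]
  set u : Fin d → ℝ := lb • Pi.single i₀ 1 + Pi.single i₁ 1 with hu_def
  have hu : ∑ i, u i ^ 2 = 1 + lb ^ 2 := by
    have hi : ∀ i, u i ^ 2
        = (Pi.single i₀ (lb ^ 2) : Fin d → ℝ) i + (Pi.single i₁ 1 : Fin d → ℝ) i := fun i => by
      rcases eq_or_ne i i₀ with rfl | h₀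
      · simp [hu_def, hne]
      · rcases eq_or_ne i i₁ with rfl | h₁
        · simp [hu_def, h₀]
        · simp [hu_def, h₀, h₁]
    simp_rw [hi, Finset.sum_add_distrib, Finset.sum_pi_single', Finset.mem_univ, if_true]
    ring
  have hlin := measure_lt_abs_linear_prod_gaussianReal_le hv hε (u := u) (by rw [hu]; nlinarith)
  have hinner := measure_lt_abs_inner_prod_gaussianReal_le (ι := Fin d) hv hε
  rw [Fintype.card_fin] at hinner
  rw [ENNReal.ofReal_add (by positivity) (by positivity)]
  refine (measure_mono ?_).trans ((measure_union_le _ _).trans (add_le_add (hlin.trans ?_) hinner))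
  · intro p hp
    have hexpand : ∑ m, (u + p.1) m * (u + p.2) m - (1 + lb ^ 2)
        = ∑ i, u i * (p.1 i + p.2 i) + ∑ i, p.1 i * p.2 i := by
      rw [← hu, ← Finset.sum_sub_distrib, ← Finset.sum_add_distrib]
      refine Finset.sum_congr rfl fun i _ => ?_
      simp only [Pi.add_apply]
      ring
    rw [Set.mem_ofPred_eq, hexpand] at hp
    by_contra! hcon
    simp only [Set.mem_union, Set.mem_ofPred_eq, not_or, not_lt] at hcon
    linarith [abs_add_le (∑ i, u i * (p.1 i + p.2 i)) (∑ i, p.1 i * p.2 i), hcon.1, hcon.2]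
  · refine ENNReal.ofReal_le_ofReal ?_
    gcongr 2 * exp ?_
    linarith [sq_nonneg ε]
end

section
/- Let C be cluster-structured and let (r_j) be a reward trajectory for C. Then for every sample j = (k, s, q) and every t ≥ 0, | τ·r_j'(t) − (2(1 + l_b²)β²/N)·Σ_{m=1}^Q σ(−r_{(k,s,m)}(t)) − (2(1 − l_b²)β²/N)·Σ_{m=1}^Q σ(−r_{(k,−s,m)}(t)) − (2dv²β²/N)·σ(−r_j(t)) | ≤ (2β²Q/N)·((2Z + 4)·εv + l_b²·Z)·max_i σ(−r_i(t)), where the maximum is over all N samples i. -/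
/-- The logistic sigmoid function. -/
noncomputable def sigmoid (x : ℝ) : ℝ := 1 / (1 + Real.exp (-x))

theorem sigmoid_nonneg (x : ℝ) : 0 ≤ sigmoid x := by
  unfold sigmoid; positivity

/-- The idealised interaction of the sample `i` with the sample `(k, s, q)`: `A` inside the
cluster, `B` with the opposite cluster, an extra `D` on the diagonal. -/
def clusterModel {K Q : ℕ} (A B D : ℝ) (k : Fin K) (s : Bool) (q : Fin Q)
    (i : Fin K × Bool × Fin Q) : ℝ :=
  if i.1 = k then
    (if i.2.1 = s then A + (if i.2.2 = q then D else 0) else B)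
  else 0

theorem sum_mul_clusterModel {K Q : ℕ} (A B D : ℝ) (k : Fin K) (s : Bool) (q : Fin Q)
    (a : Fin K × Bool × Fin Q → ℝ) :
    ∑ i, a i * clusterModel A B D k s q i =
      A * ∑ m, a (k, s, m) + B * ∑ m, a (k, !s, m) + D * a (k, s, q) := by
  rw [Fintype.sum_prod_type, Finset.sum_eq_single k]
  · rw [Fintype.sum_prod_type]
    cases s <;>
    · simp [clusterModel, mul_add, Finset.sum_add_distrib, ← Finset.sum_mul]
      ring
  · intro k' _ hk'
    simp [clusterModel, hk']
  · simp

theorem sum_cluster_const {K Q : ℕ} (f : Fin K → ℝ) :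
    ∑ i : Fin K × Bool × Fin Q, f i.1 = 2 * Q * ∑ x, f x := by
  rw [Fintype.sum_prod_type, Finset.mul_sum]
  simp only [Finset.sum_const, Finset.card_univ, Fintype.card_prod, Fintype.card_bool,
    Fintype.card_fin, nsmul_eq_mul, Nat.cast_mul, Nat.cast_ofNat]

/-- Cluster-wise bounds on coefficient errors sum to a bound on the weighted error. -/
theorem abs_sum_mul_le_of_cluster_bound {K Q : ℕ} (a E : Fin K × Bool × Fin Q → ℝ) (M : ℝ)
    (ha : ∀ i, 0 ≤ a i) (haM : ∀ i, a i ≤ M) (k : Fin K) (S : Finset (Fin K)) (hS : k ∉ S)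
    (δ η : ℝ) (hown : ∀ i, i.1 = k → |E i| ≤ δ) (hnear : ∀ i, i.1 ∈ S → |E i| ≤ η)
    (hfar : ∀ i, i.1 ≠ k → i.1 ∉ S → E i = 0) :
    |∑ i, a i * E i| ≤ 2 * Q * (δ + S.card * η) * M := by
  have hpoint : ∀ i, |a i * E i| ≤
      M * ((if i.1 = k then δ else 0) + (if i.1 ∈ S then η else 0)) := by
    intro i
    rw [abs_mul, abs_of_nonneg (ha i)]
    refine mul_le_mul (haM i) ?_ (abs_nonneg _) ((ha i).trans (haM i))
    by_cases h : i.1 = k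
    · have h' : i.1 ∉ S := h ▸ hS
      simpa [h, h', hS] using hown i h
    · by_cases h' : i.1 ∈ S
      · simpa [h, h'] using hnear i h'
      · simp [h, h', hfar i h h']
  refine (Finset.abs_sum_le_sum_abs _ _).trans ((Finset.sum_le_sum fun i _ => hpoint i).trans ?_)
  rw [← Finset.mul_sum, sum_cluster_const
    (fun x => (if x = k then δ else 0) + (if x ∈ S then η else 0)), Finset.sum_add_distrib]
  apply le_of_eq
  simp
  ring

/-- Lemma A.2: for a cluster-structured interaction array `C` and a reward trajectory
`(r_j)` for `C`, the derivative of each reward margin is, up to the stated error, the sum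
of the contributions from its own cluster, the opposite cluster and the diagonal term. -/
theorem cluster_reward_derivative_approximation
    (K Q d Z : ℕ) (hK : 1 ≤ K) (hQ : 1 ≤ Q) (hd : 1 ≤ d)
    (τ β v ε lb : ℝ) (hτ : 0 < τ) (hβ : 0 < β) (hv : 0 < v) (hε : 0 ≤ ε)
    (hlb0 : 0 ≤ lb) (hlb1 : lb ≤ 1)
    (N : ℕ) (hN : N = 2 * K * Q)
    (C : (Fin K × Bool × Fin Q) → (Fin K × Bool × Fin Q) → ℝ)
    (hsymm : ∀ i j, C i j = C j i)
    (hdiag : ∀ j, |C j j - 2 * (1 + lb ^ 2 + d * v ^ 2)| ≤ 4 * ε * v)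
    (hsame : ∀ (k : Fin K) (s : Bool) (q q' : Fin Q), q ≠ q' →
      |C (k, s, q) (k, s, q') - 2 * (1 + lb ^ 2)| ≤ 4 * ε * v)
    (hopp : ∀ (k : Fin K) (s : Bool) (q q' : Fin Q),
      |C (k, s, q) (k, !s, q') - 2 * (1 - lb ^ 2)| ≤ 4 * ε * v)
    (hcross : ∃ S : Fin K → Finset (Fin K), (∀ k, k ∉ S k) ∧ (∀ k, (S k).card ≤ Z) ∧
      ∀ (k k' : Fin K) (s s' : Bool) (q q' : Fin Q), k ≠ k' →
        (k' ∉ S k → C (k, s, q) (k', s', q') = 0) ∧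
        (k' ∈ S k → |C (k, s, q) (k', s', q')| ≤ lb ^ 2 + 2 * ε * v))
    (r r' : (Fin K × Bool × Fin Q) → ℝ → ℝ)
    (hr0 : ∀ j, r j 0 = 0)
    (hderiv : ∀ j t, 0 ≤ t → HasDerivAt (r j) (r' j t) t)
    (hflow : ∀ j t, 0 ≤ t →
      τ * r' j t = (β ^ 2 / (N : ℝ)) * ∑ i, sigmoid (-(r i t)) * C i j) :
    ∀ (k : Fin K) (s : Bool) (q : Fin Q) (t : ℝ), 0 ≤ t →
      |τ * r' (k, s, q) t
          - (2 * (1 + lb ^ 2) * β ^ 2 / (N : ℝ)) * ∑ m : Fin Q, sigmoid (-(r (k, s, m) t))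
          - (2 * (1 - lb ^ 2) * β ^ 2 / (N : ℝ)) * ∑ m : Fin Q, sigmoid (-(r (k, !s, m) t))
          - (2 * d * v ^ 2 * β ^ 2 / (N : ℝ)) * sigmoid (-(r (k, s, q) t))|
        ≤ (2 * β ^ 2 * Q / (N : ℝ)) * ((2 * Z + 4) * ε * v + lb ^ 2 * Z) *
            ⨆ i : Fin K × Bool × Fin Q, sigmoid (-(r i t)) := by
  obtain ⟨S, hkS, hcard, hC⟩ := hcross
  intro k s q t ht
  set a : Fin K × Bool × Fin Q → ℝ := fun i => sigmoid (-(r i t)) with ha_def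
  set M := ⨆ i, a i with hM_def
  have ha : ∀ i, 0 ≤ a i := fun i => sigmoid_nonneg _
  have haM : ∀ i, a i ≤ M := fun i => le_ciSup (Set.finite_range a).bddAbove i
  have hM : 0 ≤ M := (ha (k, s, q)).trans (haM _)
  set A := 2 * (1 + lb ^ 2)
  set B := 2 * (1 - lb ^ 2)
  set D := 2 * (d : ℝ) * v ^ 2
  set P := clusterModel A B D k s q with hP_def
  have hbound : |∑ i, a i * (C i (k, s, q) - P i)| ≤
      2 * Q * (4 * ε * v + (S k).card * (lb ^ 2 + 2 * ε * v)) * M := by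
    refine abs_sum_mul_le_of_cluster_bound a _ M ha haM k (S k) (hkS k) _ _ ?_ ?_ ?_
    · rintro ⟨k', s', m⟩ h
      obtain rfl : k' = k := h
      rw [hsymm]
      by_cases hs : s' = s
      · subst hs
        by_cases hm : m = q
        · subst hm
          have h := hdiag (k', s', m)
          have e : P (k', s', m) = 2 * (1 + lb ^ 2 + d * v ^ 2) := by
            simp [P, clusterModel, A, D]; ring
          rwa [e]
        · have e : P (k', s', m) = 2 * (1 + lb ^ 2) := by
            simp [P, clusterModel, hm, A]
          rw [e]
          exact hsame k' s' q m (Ne.symm hm)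
      · have e : P (k', s', m) = 2 * (1 - lb ^ 2) := by
          simp [P, clusterModel, hs, B]
        rw [e, (Bool.eq_not.mpr hs : s' = !s)]
        exact hopp k' s q m
    · rintro ⟨k', s', m⟩ h
      have hne : k' ≠ k := fun e => hkS k (e ▸ h)
      have e : P (k', s', m) = 0 := by simp [P, clusterModel, hne]
      rw [hsymm, e, sub_zero]
      exact (hC k k' s s' q m hne.symm).2 h
    · rintro ⟨k', s', m⟩ hne h
      have e : P (k', s', m) = 0 := if_neg hne
      rw [hsymm, e, sub_zero]
      exact (hC k k' s s' q m (Ne.symm hne)).1 h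
  have hcardR : ((S k).card : ℝ) ≤ Z := by exact_mod_cast hcard k
  have hη : 0 ≤ lb ^ 2 + 2 * ε * v := by positivity
  have hkey : τ * r' (k, s, q) t - A * β ^ 2 / N * ∑ m, a (k, s, m)
      - B * β ^ 2 / N * ∑ m, a (k, !s, m) - D * β ^ 2 / N * a (k, s, q)
      = β ^ 2 / N * ∑ i, a i * (C i (k, s, q) - P i) := by
    simp only [mul_sub, Finset.sum_sub_distrib]
    rw [hP_def, sum_mul_clusterModel, hflow _ t ht]
    ring
  change |τ * r' (k, s, q) t - A * β ^ 2 / N * ∑ m, a (k, s, m)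
      - B * β ^ 2 / N * ∑ m, a (k, !s, m) - D * β ^ 2 / N * a (k, s, q)| ≤ _
  have hβN : 0 ≤ β ^ 2 / (N : ℝ) := by positivity
  rw [hkey, abs_mul, abs_of_nonneg hβN]
  calc β ^ 2 / (N : ℝ) * |∑ i, a i * (C i (k, s, q) - P i)|
      ≤ β ^ 2 / N * (2 * Q * (4 * ε * v + (S k).card * (lb ^ 2 + 2 * ε * v)) * M) := by gcongr
    _ ≤ β ^ 2 / N * (2 * Q * (4 * ε * v + Z * (lb ^ 2 + 2 * ε * v)) * M) := by gcongr
    _ = _ := by ring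
end

section
/- Assume Z·l_b² ≤ 1/4, ε·v·(Z + 2) ≤ 1/16, d ≤ 5Q and v ≤ 1/(4√Q). Let C be cluster-structured and let (r_j) be a reward trajectory for C. Set τ₁ = N·τ·log 3/(10·Q·β²). Then for every sample j and every t ∈ [0, τ₁], (Qβ²/(4Nτ))·t ≤ r_j(t) ≤ (10Qβ²/(Nτ))·t; in particular, (log 3)/40 ≤ r_j(τ₁) ≤ log 3 for every sample j, so every training sample has strictly positive reward margin at time τ₁. -/
/-- The time horizon `τ₁ = N·τ·log 3/(10·Q·β²)`. -/
noncomputable def tau1 (N Q : ℕ) (τ β : ℝ) : ℝ :=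
  N * τ * Real.log 3 / (10 * Q * β ^ 2)

lemma sigmoid_pos (x : ℝ) : 0 < sigmoid x := by
  unfold sigmoid; positivity

lemma sigmoid_le_one (x : ℝ) : sigmoid x ≤ 1 := by
  unfold sigmoid
  rw [div_le_one (by positivity)]
  linarith [Real.exp_pos (-x)]

lemma quarter_le_sigmoid_neg {x : ℝ} (hx : x ≤ Real.log 3) : 1 / 4 ≤ sigmoid (-x) := by
  have h : Real.exp x ≤ 3 := (Real.le_log_iff_exp_le (by norm_num)).1 hx
  unfold sigmoid
  rw [neg_neg]
  exact one_div_le_one_div_of_le (by positivity) (by linarith)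

lemma mul_le_add_of_abs_sub_le {a c x e : ℝ} (ha0 : 0 ≤ a) (ha1 : a ≤ 1) (hc : 0 ≤ c)
    (h : |x - c| ≤ e) : a * x ≤ c + e := by
  have he : 0 ≤ e := (abs_nonneg _).trans h
  have h2 := (abs_le.1 h).2
  nlinarith [mul_nonneg ha0 (sub_nonneg.2 h2),
    mul_nonneg (sub_nonneg.2 ha1) (add_nonneg hc he)]

lemma mul_sub_le_mul_of_abs_sub_le {p a c x e : ℝ} (hp : p ≤ a) (ha0 : 0 ≤ a) (ha1 : a ≤ 1)
    (hc : 0 ≤ c) (h : |x - c| ≤ e) : p * c - e ≤ a * x := by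
  have he : 0 ≤ e := (abs_nonneg _).trans h
  have h1 := (abs_le.1 h).1
  nlinarith [mul_nonneg ha0 (sub_nonneg.2 h1), mul_nonneg (sub_nonneg.2 ha1) he,
    mul_nonneg (sub_nonneg.2 hp) hc]

lemma mul_le_of_le_hasDerivAt {f f' : ℝ → ℝ} {c T t : ℝ} (h0 : f 0 = 0)
    (hf : ∀ s, 0 ≤ s → HasDerivAt f (f' s) s) (hc : ∀ s, 0 ≤ s → s ≤ T → c ≤ f' s)
    (ht : 0 ≤ t) (htT : t ≤ T) : c * t ≤ f t := by
  have h := (convex_Icc (0 : ℝ) T).mul_sub_le_image_sub_of_le_deriv (f := f) (C := c)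
    (fun s hs => (hf s hs.1).continuousAt.continuousWithinAt)
    (fun s hs => (hf s (interior_subset hs).1).differentiableAt.differentiableWithinAt)
    (fun s hs => by
      have hs := interior_subset hs
      rw [(hf s hs.1).deriv]
      exact hc s hs.1 hs.2)
    0 ⟨le_rfl, ht.trans htT⟩ t ⟨ht, htT⟩ ht
  simpa [h0] using h

lemma le_mul_of_hasDerivAt_le {f f' : ℝ → ℝ} {c T t : ℝ} (h0 : f 0 = 0)
    (hf : ∀ s, 0 ≤ s → HasDerivAt f (f' s) s) (hc : ∀ s, 0 ≤ s → s ≤ T → f' s ≤ c)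
    (ht : 0 ≤ t) (htT : t ≤ T) : f t ≤ c * t := by
  have h := mul_le_of_le_hasDerivAt (f := fun s => -f s) (f' := fun s => -f' s) (c := -c)
    (by simp [h0]) (fun s hs => (hf s hs).neg) (fun s hs hsT => neg_le_neg (hc s hs hsT)) ht htT
  linarith

/-- The nominal value of a cluster-structured array at the samples `i` and `j`, where `x` and `y`
are the values for equal and opposite signs in the same pair and `z` is the extra diagonal term. -/
def nominal {K Q : ℕ} (x y z : ℝ) (j i : Fin K × Bool × Fin Q) : ℝ :=
  (if i.1 = j.1 then if i.2.1 = j.2.1 then x else y else 0) + if i = j then z else 0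

/-- The allowed deviation from `nominal`: `e` within a cluster pair, `w` for linked pairs. -/
def deviation {K Q : ℕ} (S : Finset (Fin K)) (e w : ℝ) (j i : Fin K × Bool × Fin Q) : ℝ :=
  (if i.1 = j.1 then e else 0) + if i.1 ∈ S then w else 0

lemma nominal_nonneg {K Q : ℕ} {x y z : ℝ} (hx : 0 ≤ x) (hy : 0 ≤ y) (hz : 0 ≤ z)
    (j i : Fin K × Bool × Fin Q) : 0 ≤ nominal x y z j i := by
  unfold nominal
  split_ifs <;> positivity

lemma sum_nominal {K Q : ℕ} (x y z : ℝ) (j : Fin K × Bool × Fin Q) :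
    ∑ i, nominal x y z j i = Q * (x + y) + z := by
  obtain ⟨k, s, q⟩ := j
  simp only [nominal, Finset.sum_add_distrib, Finset.sum_ite_eq', Finset.mem_univ, if_true]
  rw [Fintype.sum_prod_type, Finset.sum_eq_single k (fun b _ hb => by simp [hb]) (by simp),
    Fintype.sum_prod_type]
  cases s <;> simp <;> ring

lemma sum_comp_fst {K Q : ℕ} (f : Fin K → ℝ) :
    ∑ i : Fin K × Bool × Fin Q, f i.1 = 2 * Q * ∑ k, f k := by
  simp [Fintype.sum_prod_type, Finset.mul_sum, mul_assoc]

lemma sum_deviation {K Q : ℕ} (S : Finset (Fin K)) (e w : ℝ) (j : Fin K × Bool × Fin Q) :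
    ∑ i, deviation S e w j i = 2 * Q * (e + S.card * w) := by
  unfold deviation
  rw [sum_comp_fst fun k => (if k = j.1 then e else 0) + if k ∈ S then w else 0]
  simp [Finset.sum_add_distrib]

lemma abs_sub_nominal_le {K Q : ℕ} {u lb D w : ℝ} {S : Finset (Fin K)}
    {C : (Fin K × Bool × Fin Q) → (Fin K × Bool × Fin Q) → ℝ}
    (hsymm : ∀ i j, C i j = C j i)
    (hdiag : ∀ j, |C j j - 2 * (1 + lb ^ 2 + D)| ≤ u)
    (hsame : ∀ (k : Fin K) (s : Bool) (q q' : Fin Q), q ≠ q' →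
      |C (k, s, q) (k, s, q') - 2 * (1 + lb ^ 2)| ≤ u)
    (hopp : ∀ (k : Fin K) (s : Bool) (q q' : Fin Q),
      |C (k, s, q) (k, !s, q') - 2 * (1 - lb ^ 2)| ≤ u)
    {j : Fin K × Bool × Fin Q} (hj : j.1 ∉ S)
    (hcross : ∀ i : Fin K × Bool × Fin Q, j.1 ≠ i.1 →
      (i.1 ∉ S → C j i = 0) ∧ (i.1 ∈ S → |C j i| ≤ w))
    (i : Fin K × Bool × Fin Q) :
    |C i j - nominal (2 * (1 + lb ^ 2)) (2 * (1 - lb ^ 2)) (2 * D) j i|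
      ≤ deviation S u w j i := by
  rw [hsymm]
  by_cases hk : i.1 = j.1
  · obtain ⟨k, s, q⟩ := j
    obtain ⟨k', s', q'⟩ := i
    obtain rfl : k' = k := hk
    simp only [nominal, deviation, if_true, Prod.mk.injEq, true_and] at hj ⊢
    rw [if_neg hj, add_zero]
    by_cases hs : s' = s
    · subst hs
      by_cases hq : q' = q
      · subst hq
        simpa [mul_add] using hdiag (k', s', q')
      · simpa [hq] using hsame k' s' q q' (Ne.symm hq)
    · obtain rfl : s' = !s := Bool.eq_not.2 hs
      simpa using hopp k' s q q'
  · have hij : i ≠ j := fun h => hk (h ▸ rfl)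
    obtain ⟨h0, h1⟩ := hcross i (Ne.symm hk)
    by_cases hS : i.1 ∈ S
    · simpa [nominal, deviation, hk, hij, hS] using h1 hS
    · simp [nominal, deviation, hk, hij, hS, h0 hS]

/-- Deterministic core of the Training Reward Guarantee (Theorem 3.1): under the
cluster-structured hypotheses on `C`, every reward margin trajectory is squeezed between
the linear bounds `(Qβ²/(4Nτ))·t` and `(10Qβ²/(Nτ))·t` on `[0, τ₁]`; in particular at
`τ₁` every training sample satisfies `(log 3)/40 ≤ r ≤ log 3`, hence has strictly
positive reward margin. -/
theorem training_reward_guarantee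
    (K Q d Z : ℕ) (hK : 1 ≤ K) (hQ : 1 ≤ Q) (hd : 1 ≤ d)
    (τ β v ε lb : ℝ) (hτ : 0 < τ) (hβ : 0 < β) (hv : 0 < v) (hε : 0 ≤ ε)
    (hlb0 : 0 ≤ lb) (hlb1 : lb ≤ 1)
    (hZlb : (Z : ℝ) * lb ^ 2 ≤ 1 / 4)
    (hεv : ε * v * ((Z : ℝ) + 2) ≤ 1 / 16)
    (hdQ : d ≤ 5 * Q)
    (hvQ : v ≤ 1 / (4 * Real.sqrt Q))
    (N : ℕ) (hN : N = 2 * K * Q)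
    (C : (Fin K × Bool × Fin Q) → (Fin K × Bool × Fin Q) → ℝ)
    (hsymm : ∀ i j, C i j = C j i)
    (hdiag : ∀ j, |C j j - 2 * (1 + lb ^ 2 + d * v ^ 2)| ≤ 4 * ε * v)
    (hsame : ∀ (k : Fin K) (s : Bool) (q q' : Fin Q), q ≠ q' →
      |C (k, s, q) (k, s, q') - 2 * (1 + lb ^ 2)| ≤ 4 * ε * v)
    (hopp : ∀ (k : Fin K) (s : Bool) (q q' : Fin Q),
      |C (k, s, q) (k, !s, q') - 2 * (1 - lb ^ 2)| ≤ 4 * ε * v)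
    (hcross : ∃ S : Fin K → Finset (Fin K), (∀ k, k ∉ S k) ∧ (∀ k, (S k).card ≤ Z) ∧
      ∀ (k k' : Fin K) (s s' : Bool) (q q' : Fin Q), k ≠ k' →
        (k' ∉ S k → C (k, s, q) (k', s', q') = 0) ∧
        (k' ∈ S k → |C (k, s, q) (k', s', q')| ≤ lb ^ 2 + 2 * ε * v))
    (r r' : (Fin K × Bool × Fin Q) → ℝ → ℝ)
    (hr0 : ∀ j, r j 0 = 0)
    (hderiv : ∀ j t, 0 ≤ t → HasDerivAt (r j) (r' j t) t)
    (hflow : ∀ j t, 0 ≤ t →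
      τ * r' j t = (β ^ 2 / (N : ℝ)) * ∑ i, sigmoid (-(r i t)) * C i j) :
    (∀ (j : Fin K × Bool × Fin Q) (t : ℝ), 0 ≤ t → t ≤ tau1 N Q τ β →
        (Q * β ^ 2 / (4 * N * τ)) * t ≤ r j t ∧ r j t ≤ (10 * Q * β ^ 2 / (N * τ)) * t)
    ∧ ∀ j : Fin K × Bool × Fin Q,
        Real.log 3 / 40 ≤ r j (tau1 N Q τ β)
        ∧ r j (tau1 N Q τ β) ≤ Real.log 3
        ∧ 0 < r j (tau1 N Q τ β) := by
  obtain ⟨S, hSself, hScard, hcross⟩ := hcross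
  have hQ1 : (1 : ℝ) ≤ Q := by exact_mod_cast hQ
  have hQ0 : (0 : ℝ) < Q := by linarith
  have hN0 : (0 : ℝ) < N := by
    have : 0 < N := by rw [hN]; positivity
    exact_mod_cast this
  have hlog : 0 < Real.log 3 := Real.log_pos (by norm_num)
  have hlb2 : lb ^ 2 ≤ 1 := pow_le_one₀ hlb0 hlb1
  have hD : (d : ℝ) * v ^ 2 ≤ 5 / 16 := by
    have hv2 : v ^ 2 ≤ 1 / (16 * Q) := by
      calc v ^ 2 ≤ (1 / (4 * Real.sqrt Q)) ^ 2 := pow_le_pow_left₀ hv.le hvQ 2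
        _ = 1 / (16 * Q) := by
          rw [div_pow, mul_pow, Real.sq_sqrt hQ0.le]; norm_num
    have hd' : (d : ℝ) ≤ 5 * Q := by exact_mod_cast hdQ
    calc (d : ℝ) * v ^ 2 ≤ 5 * Q * (1 / (16 * Q)) := by gcongr
      _ = 5 / 16 := by field_simp
  set c := nominal (K := K) (Q := Q) (2 * (1 + lb ^ 2)) (2 * (1 - lb ^ 2)) (2 * (d * v ^ 2))
    with hc_def
  have hc0 : ∀ j i, 0 ≤ c j i :=
    nominal_nonneg (by positivity) (by linarith) (by positivity)
  have hdev : ∀ j i, |C i j - c j i|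
      ≤ deviation (S j.1) (4 * ε * v) (lb ^ 2 + 2 * ε * v) j i := fun j =>
    abs_sub_nominal_le hsymm hdiag hsame hopp (hSself j.1)
      (fun i hi => hcross j.1 i.1 j.2.1 i.2.1 j.2.2 i.2.2 hi)
  have hcsum : ∀ j, ∑ i, c j i = 4 * Q + 2 * (d * v ^ 2) := fun j => by
    rw [hc_def, sum_nominal]; ring
  have hdevsum : ∀ j : Fin K × Bool × Fin Q,
      ∑ i, deviation (S j.1) (4 * ε * v) (lb ^ 2 + 2 * ε * v) j i ≤ 3 / 4 * Q := fun j => by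
    rw [sum_deviation]
    have hcard : ((S j.1).card : ℝ) ≤ Z := by exact_mod_cast hScard j.1
    have h : ((S j.1).card : ℝ) * (lb ^ 2 + 2 * ε * v) ≤ Z * (lb ^ 2 + 2 * ε * v) := by
      gcongr
    nlinarith
  have hupper : ∀ j t, 0 ≤ t → r' j t ≤ 10 * Q * β ^ 2 / (N * τ) := fun j t ht => by
    have hsum : ∑ i, sigmoid (-(r i t)) * C i j ≤ 10 * Q := by
      have h := Finset.sum_le_sum fun i (_ : i ∈ Finset.univ) =>
        mul_le_add_of_abs_sub_le (sigmoid_pos (-(r i t))).le (sigmoid_le_one _) (hc0 j i)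
          (hdev j i)
      rw [Finset.sum_add_distrib, hcsum] at h
      linarith [hdevsum j]
    have h : τ * r' j t ≤ β ^ 2 / N * (10 * Q) := by
      rw [hflow j t ht]; gcongr
    rw [← le_div_iff₀' hτ] at h
    exact h.trans_eq (by field_simp)
  have hle : ∀ j t, 0 ≤ t → t ≤ tau1 N Q τ β → r j t ≤ 10 * Q * β ^ 2 / (N * τ) * t :=
    fun j t ht htT =>
      le_mul_of_hasDerivAt_le (hr0 j) (hderiv j) (fun s hs _ => hupper j s hs) ht htT
  have htau : 10 * Q * β ^ 2 / (N * τ) * tau1 N Q τ β = Real.log 3 := by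
    unfold tau1; field_simp
  have hlelog : ∀ j t, 0 ≤ t → t ≤ tau1 N Q τ β → r j t ≤ Real.log 3 := fun j t ht htT =>
    (hle j t ht htT).trans (by rw [← htau]; gcongr)
  have hlower : ∀ j t, 0 ≤ t → t ≤ tau1 N Q τ β → Q * β ^ 2 / (4 * N * τ) ≤ r' j t :=
      fun j t ht htT => by
    have hsum : Q / 4 ≤ ∑ i, sigmoid (-(r i t)) * C i j := by
      have h := Finset.sum_le_sum fun i (_ : i ∈ Finset.univ) =>
        mul_sub_le_mul_of_abs_sub_le (quarter_le_sigmoid_neg (hlelog i t ht htT))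
          (sigmoid_pos (-(r i t))).le (sigmoid_le_one _) (hc0 j i) (hdev j i)
      rw [Finset.sum_sub_distrib, ← Finset.mul_sum, hcsum] at h
      have : 0 ≤ (d : ℝ) * v ^ 2 := by positivity
      linarith [hdevsum j]
    have h : β ^ 2 / N * (Q / 4) ≤ τ * r' j t := by
      rw [hflow j t ht]; gcongr
    rw [← div_le_iff₀' hτ] at h
    exact le_of_eq_of_le (by field_simp) h
  have hge : ∀ j t, 0 ≤ t → t ≤ tau1 N Q τ β → Q * β ^ 2 / (4 * N * τ) * t ≤ r j t :=
    fun j t ht htT => mul_le_of_le_hasDerivAt (hr0 j) (hderiv j) (hlower j) ht htT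
  have htau0 : 0 ≤ tau1 N Q τ β := by unfold tau1; positivity
  have htau' : Q * β ^ 2 / (4 * N * τ) * tau1 N Q τ β = Real.log 3 / 40 := by
    unfold tau1; field_simp; norm_num
  refine ⟨fun j t ht htT => ⟨hge j t ht htT, hle j t ht htT⟩, fun j => ?_⟩
  have h40 : Real.log 3 / 40 ≤ r j (tau1 N Q τ β) := htau' ▸ hge j _ htau0 le_rfl
  exact ⟨h40, hlelog j _ htau0 le_rfl, by linarith⟩
end
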